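/- For every ideal I ⊆ K[X][U], the collection of Gröbner cones of I is finite: the set {C_≺(I) : ≺ a monomial order on K[X][U]} has only finitely many distinct members; equivalently, the set of initial ideals {⟨lt_≺(I)⟩ : ≺ a monomial order} is finite. -/

import Mathlib

open MvPolynomial

/-- A monomial order on exponent vectors in `Fin N →₀ ℕ`:
a linear order compatible with addition in which `0` is the least element. -/
structure MonoOrder (N : ℕ) where
  lt : (Fin N →₀ ℕ) → (Fin N →₀ ℕ) → Prop
  total : ∀ a b, a = b ∨ lt a b ∨ lt b a
  trans : ∀ a b c, lt a b → lt b c → lt a c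
  irrefl : ∀ a, ¬ lt a a
  add_right : ∀ a b c, lt a b → lt (a + c) (b + c)
  zero_lt : ∀ a, a ≠ 0 → lt 0 a

variable {N : ℕ} {K : Type*} [Field K]

/-- The ω-degree `ω · d` of an exponent vector `d`. -/
noncomputable def wdeg (ω : Fin N → ℝ) (d : Fin N → ℕ) : ℝ :=
  ∑ i, ω i * (d i : ℝ)

/-- The ≺-maximal exponent in the support of `p` (the exponent of the leading term). -/
noncomputable def leadExp (mo : MonoOrder N) (p : MvPolynomial (Fin N) K) : Fin N →₀ ℕ :=
  open Classical in
  if h : ∃ d ∈ p.support, ∀ e ∈ p.support, e ≠ d → mo.lt e d then h.choose else 0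

/-- The leading term `lt_≺(p)` of `p` w.r.t. the monomial order `mo`. -/
noncomputable def leadTerm (mo : MonoOrder N) (p : MvPolynomial (Fin N) K) :
    MvPolynomial (Fin N) K :=
  monomial (leadExp mo p) (p.coeff (leadExp mo p))

/-- `p ∈ K[X]`: the polynomial `p` involves only the first `n` variables. -/
def inKX (n : ℕ) (p : MvPolynomial (Fin N) K) : Prop :=
  ∀ d ∈ p.support, ∀ i : Fin N, n ≤ (i : ℕ) → d i = 0

open Classical in
/-- Initial form `lt_ω(p)`: the sum of the terms of `p` of maximal ω-degree. -/
noncomputable def initForm (ω : Fin N → ℝ) (p : MvPolynomial (Fin N) K) :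
    MvPolynomial (Fin N) K :=
  ∑ d ∈ p.support.filter (fun d : Fin N →₀ ℕ => ∀ e ∈ p.support, wdeg ω ⇑e ≤ wdeg ω ⇑d),
    monomial d (p.coeff d)

/-- The initial ideal `⟨lt_ω(I)⟩` w.r.t. a weight vector ω. -/
noncomputable def ltIdealW (ω : Fin N → ℝ) (I : Ideal (MvPolynomial (Fin N) K)) :
    Ideal (MvPolynomial (Fin N) K) :=
  Ideal.span (initForm ω '' (I : Set (MvPolynomial (Fin N) K)))

/-- The initial ideal `⟨lt_≺(I)⟩` w.r.t. a monomial order. -/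
noncomputable def ltIdealO (mo : MonoOrder N) (I : Ideal (MvPolynomial (Fin N) K)) :
    Ideal (MvPolynomial (Fin N) K) :=
  Ideal.span (leadTerm mo '' (I : Set (MvPolynomial (Fin N) K)))

/-- The Gröbner cone `C_≺(I)`. -/
noncomputable def gCone (mo : MonoOrder N) (I : Ideal (MvPolynomial (Fin N) K)) :
    Set (Fin N → ℝ) :=
  closure {ω | (∀ i, 0 ≤ ω i) ∧ ltIdealW ω I = ltIdealO mo I}

/-- `G` is the normed reduced Gröbner basis of `I` w.r.t. `mo`. -/
def IsRedGB (mo : MonoOrder N) (I : Ideal (MvPolynomial (Fin N) K))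
    (G : Set (MvPolynomial (Fin N) K)) : Prop :=
  G.Finite ∧ G ⊆ (I : Set (MvPolynomial (Fin N) K)) ∧
  Ideal.span (leadTerm mo '' G) = ltIdealO mo I ∧
  (∀ g ∈ G, g ≠ 0 ∧ g.coeff (leadExp mo g) = 1) ∧
  (∀ g ∈ G, ∀ h ∈ G, g ≠ h → ∀ d ∈ h.support, ¬ leadExp mo g ≤ d)

/-- `mo` is an `I`-specific elimination order for the last variables:
every element of the reduced Gröbner basis whose leading term lies in `K[X]`
lies itself in `K[X]`. -/
def IsEO (n : ℕ) (mo : MonoOrder N) (I : Ideal (MvPolynomial (Fin N) K)) : Prop :=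
  ∀ G : Set (MvPolynomial (Fin N) K), IsRedGB mo I G →
    ∀ g ∈ G, inKX n (leadTerm mo g) → inKX n g

/-- `ω` is an `I`-specific elimination vector. -/
def IsEV (n : ℕ) (I : Ideal (MvPolynomial (Fin N) K)) (ω : Fin N → ℝ) : Prop :=
  (∀ i, 0 ≤ ω i) ∧ ∃ mo : MonoOrder N, IsEO n mo I ∧ ω ∈ gCone mo I

/-- The monomial order `mo` refines the weight vector `ω`. -/
def Refines (mo : MonoOrder N) (ω : Fin N → ℝ) : Prop :=
  ∀ d e : Fin N →₀ ℕ, wdeg ω ⇑d < wdeg ω ⇑e → mo.lt d e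

/-- `Ω_u`: the set of weight vectors vanishing on the first `n` coordinates. -/
def OmegaU (n N : ℕ) : Set (Fin N → ℝ) :=
  {ω | (∀ i, 0 ≤ ω i) ∧ ∀ i : Fin N, (i : ℕ) < n → ω i = 0}

/-- `L_{X,≺}(G)`: the elements of `G` whose leading term lies in `K[X]`. -/
def LXset (n : ℕ) (mo : MonoOrder N) (G : Set (MvPolynomial (Fin N) K)) :
    Set (MvPolynomial (Fin N) K) :=
  {p ∈ G | inKX n (leadTerm mo p)}
lemma castAdd_inj (n m : ℕ) : Function.Injective (Fin.castAdd m : Fin n → Fin (n + m)) := by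
  intro a b h
  exact Fin.ext (by simpa using congrArg Fin.val h)

/-- Extend an exponent vector on the first `n` variables to all `n + m` variables. -/
noncomputable def extExp (n m : ℕ) (a : Fin n →₀ ℕ) : Fin (n + m) →₀ ℕ :=
  Finsupp.mapDomain (Fin.castAdd m) a

/-- The restriction of a monomial order on `K[X][U]` to the monomials of `K[X]`. -/
noncomputable def restrictOrder (n m : ℕ) (mo : MonoOrder (n + m)) : MonoOrder n where
  lt a b := mo.lt (extExp n m a) (extExp n m b)
  total a b := by
    rcases mo.total (extExp n m a) (extExp n m b) with h | h | h
    · exact Or.inl (Finsupp.mapDomain_injective (castAdd_inj n m) h)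
    · exact Or.inr (Or.inl h)
    · exact Or.inr (Or.inr h)
  trans a b c hab hbc := mo.trans _ _ _ hab hbc
  irrefl a := mo.irrefl _
  add_right a b c h := by
    show mo.lt (extExp n m (a + c)) (extExp n m (b + c))
    rw [show extExp n m (a + c) = extExp n m a + extExp n m c from Finsupp.mapDomain_add,
        show extExp n m (b + c) = extExp n m b + extExp n m c from Finsupp.mapDomain_add]
    exact mo.add_right _ _ _ h
  zero_lt a ha := by
    show mo.lt (extExp n m 0) (extExp n m a)
    have h0 : extExp n m (0 : Fin n →₀ ℕ) = 0 := Finsupp.mapDomain_zero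
    rw [h0]
    refine mo.zero_lt _ (fun h => ha ?_)
    exact Finsupp.mapDomain_injective (castAdd_inj n m) (h.trans h0.symm)

/-- The projection `K[X][U] → K[X]` sending each `u`-variable to `0`;
on polynomials of `K[X]` it inverts the canonical inclusion `K[X] → K[X][U]`. -/
noncomputable def projX (n m : ℕ) (K : Type*) [Field K] :
    MvPolynomial (Fin (n + m)) K →ₐ[K] MvPolynomial (Fin n) K :=
  aeval (fun i : Fin (n + m) => if h : (i : ℕ) < n then X ⟨(i : ℕ), h⟩ else 0)

/-- The elimination ideal `I ∩ K[X]`, viewed as an ideal of `K[x_1,…,x_n]` via the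
canonical inclusion `K[X] → K[X][U]`. -/
noncomputable def elimIdeal (n m : ℕ) {K : Type*} [Field K]
    (I : Ideal (MvPolynomial (Fin (n + m)) K)) : Ideal (MvPolynomial (Fin n) K) :=
  Ideal.comap
    (rename (Fin.castAdd m) : MvPolynomial (Fin n) K →ₐ[K] MvPolynomial (Fin (n + m)) K) I

/-- Priority of the variables for the lex order `u_1 ≻ … ≻ u_m ≻ x_1 ≻ … ≻ x_n`
(smaller priority value = more significant variable). -/
def uPrio (n m : ℕ) (i : Fin (n + m)) : ℕ :=
  if (i : ℕ) < n then m + (i : ℕ) else (i : ℕ) - n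

/-- The pure lexicographic order with `u_1 ≻ … ≻ u_m ≻ x_1 ≻ … ≻ x_n`:
`a <_lex b` iff at the most significant position where they differ, `a` is smaller. -/
def uLexLt (n m : ℕ) (a b : Fin (n + m) →₀ ℕ) : Prop :=
  ∃ i : Fin (n + m), a i < b i ∧ ∀ j : Fin (n + m), uPrio n m j < uPrio n m i → a j = b j
namespace MonoOrder

lemma eq_or_lt_of_le (mo : MonoOrder N) {a b : Fin N →₀ ℕ} (h : a ≤ b) : a = b ∨ mo.lt a b := by
  rcases eq_or_ne (b - a) 0 with h0 | h0
  · left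
    rw [← tsub_add_cancel_of_le h, h0, zero_add]
  · right
    have := mo.add_right _ _ a (mo.zero_lt _ h0)
    rwa [zero_add, tsub_add_cancel_of_le h] at this

lemma wellFounded_lt (mo : MonoOrder N) : WellFounded mo.lt := by
  rw [wellFounded_iff_isEmpty_descending_chain]
  refine ⟨fun ⟨f, hf⟩ => ?_⟩
  have hlt : ∀ i j, i < j → mo.lt (f j) (f i) := by
    intro i j hij
    induction j, hij using Nat.le_induction with
    | base => exact hf i
    | succ j _ ih => exact mo.trans _ _ _ (hf j) ih
  obtain ⟨i, j, hij, hle⟩ := wellQuasiOrdered_le f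
  rcases mo.eq_or_lt_of_le hle with h | h
  · exact mo.irrefl _ (h ▸ hlt i j hij)
  · exact mo.irrefl _ (mo.trans _ _ _ h (hlt i j hij))

lemma exists_max (mo : MonoOrder N) {s : Finset (Fin N →₀ ℕ)} (hs : s.Nonempty) :
    ∃ d ∈ s, ∀ e ∈ s, e ≠ d → mo.lt e d := by
  induction hs using Finset.Nonempty.cons_induction with
  | singleton a => exact ⟨a, by simp⟩
  | cons a s _ _ ih =>
    obtain ⟨d, hd, hmax⟩ := ih
    rcases mo.total a d with h | h | h
    · subst h
      exact ⟨a, by simp, by simpa using fun e he => hmax e he⟩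
    · refine ⟨d, by simp [hd], fun e he hne => ?_⟩
      rcases Finset.mem_cons.1 he with rfl | he
      exacts [h, hmax e he hne]
    · refine ⟨a, by simp, fun e he hne => ?_⟩
      rcases Finset.mem_cons.1 he with rfl | he
      · exact absurd rfl hne
      · rcases eq_or_ne e d with rfl | hed
        exacts [h, mo.trans _ _ _ (hmax e he hed) h]

/-- The ultraproduct of a family of monomial orders: `a` is below `b` iff this holds for
almost all members of the family. -/
def ultralimit {ι : Type*} (l : Ultrafilter ι) (mo : ι → MonoOrder N) : MonoOrder N where
  lt a b := ∀ᶠ i in (l : Filter ι), (mo i).lt a b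
  total a b := by
    rw [or_iff_not_imp_left, ← Ultrafilter.eventually_or]
    exact fun h => Filter.Eventually.of_forall fun i => ((mo i).total a b).resolve_left h
  trans a b c hab hbc := by
    filter_upwards [hab, hbc] with i using (mo i).trans a b c
  irrefl a h := by
    obtain ⟨i, hi⟩ := h.exists
    exact (mo i).irrefl a hi
  add_right a b c h := by
    filter_upwards [h] with i using (mo i).add_right a b c
  zero_lt a ha := Filter.Eventually.of_forall fun i => (mo i).zero_lt a ha

end MonoOrder

section LeadingExponents

variable {mo : MonoOrder N} {p : MvPolynomial (Fin N) K} {I : Ideal (MvPolynomial (Fin N) K)}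

lemma leadExp_spec (mo : MonoOrder N) (hp : p ≠ 0) :
    leadExp mo p ∈ p.support ∧ ∀ e ∈ p.support, e ≠ leadExp mo p → mo.lt e (leadExp mo p) := by
  have h := mo.exists_max (support_nonempty.2 hp)
  rw [leadExp, dif_pos h]
  exact h.choose_spec

lemma leadExp_eq_of_forall_lt {d : Fin N →₀ ℕ} (hd : d ∈ p.support)
    (hmax : ∀ e ∈ p.support, e ≠ d → mo.lt e d) : leadExp mo p = d := by
  have hp : p ≠ 0 := by
    rintro rfl
    simp at hd
  obtain ⟨hmem, hlead⟩ := leadExp_spec mo hp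
  by_contra hne
  exact mo.irrefl _ (mo.trans _ _ _ (hmax _ hmem hne) (hlead d hd (Ne.symm hne)))

/-- The leading exponents of the nonzero elements of `I`. -/
def leadExps (mo : MonoOrder N) (I : Ideal (MvPolynomial (Fin N) K)) : Set (Fin N →₀ ℕ) :=
  {a | ∃ f ∈ I, f ≠ 0 ∧ leadExp mo f = a}

lemma ltIdealO_eq_span_leadExps (mo : MonoOrder N) (I : Ideal (MvPolynomial (Fin N) K)) :
    ltIdealO mo I = Ideal.span ((fun a => monomial a (1 : K)) '' leadExps mo I) := by
  apply le_antisymm <;> refine Ideal.span_le.2 ?_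
  · rintro _ ⟨f, hf, rfl⟩
    rcases eq_or_ne f 0 with rfl | hf0
    · simp [leadTerm]
    · have h : leadTerm mo f
          = C (f.coeff (leadExp mo f)) * monomial (leadExp mo f) (1 : K) := by
        simp [leadTerm, C_mul_monomial]
      rw [h]
      exact Ideal.mul_mem_left _ _ (Ideal.subset_span ⟨_, ⟨f, hf, hf0, rfl⟩, rfl⟩)
  · rintro _ ⟨_, ⟨f, hf, hf0, rfl⟩, rfl⟩
    have hc : f.coeff (leadExp mo f) ≠ 0 := mem_support_iff.1 (leadExp_spec mo hf0).1
    have h : monomial (leadExp mo f) (1 : K)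
        = C (f.coeff (leadExp mo f))⁻¹ * leadTerm mo f := by
      simp [leadTerm, C_mul_monomial, hc]
    simp only [h]
    exact Ideal.mul_mem_left _ _ (Ideal.subset_span ⟨f, hf, rfl⟩)

lemma isUpperSet_leadExps (mo : MonoOrder N) (I : Ideal (MvPolynomial (Fin N) K)) :
    IsUpperSet (leadExps mo I) := by
  rintro _ b hab ⟨f, hf, hf0, rfl⟩
  obtain ⟨hmem, hlead⟩ := leadExp_spec mo hf0
  obtain ⟨c, rfl⟩ := exists_add_of_le hab
  have hd : leadExp mo f + c ∈ (f * monomial c (1 : K)).support := by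
    simpa [mem_support_iff, coeff_mul_monomial] using hmem
  refine ⟨f * monomial c 1, I.mul_mem_right _ hf, support_nonempty.1 ⟨_, hd⟩,
    leadExp_eq_of_forall_lt hd fun e he hne => ?_⟩
  rw [mem_support_iff, coeff_mul_monomial'] at he
  split_ifs at he with hce
  · have hlt := mo.add_right _ _ c (hlead (e - c) (by simpa using he) fun h => hne (by
      rw [← h, tsub_add_cancel_of_le hce]))
    rwa [tsub_add_cancel_of_le hce] at hlt
  · exact absurd rfl he

/-- Modulo `I`, every term is congruent to a polynomial supported on standard monomials. -/
lemma monomial_mem_sup_restrictSupport (mo : MonoOrder N) (I : Ideal (MvPolynomial (Fin N) K))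
    (a : Fin N →₀ ℕ) (c : K) :
    monomial a c ∈ I.restrictScalars K ⊔ restrictSupport K (leadExps mo I)ᶜ := by
  induction a using mo.wellFounded_lt.induction generalizing c with
  | _ a ih =>
    by_cases ha : a ∈ leadExps mo I
    · obtain ⟨f, hf, hf0, rfl⟩ := ha
      obtain ⟨hmem, hlead⟩ := leadExp_spec mo hf0
      set a := leadExp mo f
      have hc : f.coeff a ≠ 0 := mem_support_iff.1 hmem
      have hsum : f = monomial a (f.coeff a)
          + ∑ e ∈ f.support.erase a, monomial e (f.coeff e) := by
        rw [Finset.add_sum_erase _ (fun e => monomial e (f.coeff e)) hmem, support_sum_monomial_coeff]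
      have hlc : monomial a c
          = (c * (f.coeff a)⁻¹) • (f - ∑ e ∈ f.support.erase a, monomial e (f.coeff e)) := by
        rw [← eq_sub_iff_add_eq.2 hsum.symm, smul_monomial, smul_eq_mul,
          inv_mul_cancel_right₀ hc]
      rw [hlc]
      refine Submodule.smul_mem _ _ (Submodule.sub_mem _ (Submodule.mem_sup_left hf)
        (Submodule.sum_mem _ fun e he => ih e ?_ _))
      exact hlead e (Finset.mem_of_mem_erase he) (Finset.ne_of_mem_erase he)
    · refine Submodule.mem_sup_right ((mem_restrictSupport_iff ..).2 fun e he => ?_)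
      rw [Finset.mem_singleton.1 (support_monomial_subset he)]
      exact ha

lemma leadExps_eq_of_subset {mo₁ mo₂ : MonoOrder N} (h : leadExps mo₁ I ⊆ leadExps mo₂ I) :
    leadExps mo₁ I = leadExps mo₂ I := by
  refine h.antisymm fun a ha₂ => ?_
  by_contra ha₁
  obtain ⟨f, hf, r, hr, hfr⟩ :=
    Submodule.mem_sup.1 (monomial_mem_sup_restrictSupport mo₂ I a 1)
  rw [mem_restrictSupport_iff] at hr
  have hra : r.coeff a = 0 := notMem_support_iff.1 fun hmem => hr hmem ha₂
  have hfa : f.coeff a = 1 := by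
    simpa [hra] using congrArg (coeff a) hfr
  have hf0 : f ≠ 0 := by
    rintro rfl
    simp at hfa
  have hlead : leadExp mo₁ f ∈ leadExps mo₁ I := ⟨f, hf, hf0, rfl⟩
  have hcoeff : f.coeff (leadExp mo₁ f) ≠ 0 := mem_support_iff.1 (leadExp_spec mo₁ hf0).1
  have hne : a ≠ leadExp mo₁ f := fun hne => ha₁ (hne ▸ hlead)
  have hfr' := congrArg (coeff (leadExp mo₁ f)) hfr
  rw [coeff_add, coeff_monomial, if_neg hne,
    notMem_support_iff.1 fun hmem => hr hmem (h hlead), add_zero] at hfr'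
  exact hcoeff hfr'

lemma eventually_leadExp_eq {ι : Type*} (l : Ultrafilter ι) (mo : ι → MonoOrder N)
    (hp : p ≠ 0) :
    ∀ᶠ i in (l : Filter ι), leadExp (mo i) p = leadExp (MonoOrder.ultralimit l mo) p := by
  obtain ⟨hmem, hlead⟩ := leadExp_spec (MonoOrder.ultralimit l mo) hp
  have h : ∀ᶠ i in (l : Filter ι), ∀ e ∈ p.support,
      e ≠ leadExp (MonoOrder.ultralimit l mo) p →
        (mo i).lt e (leadExp (MonoOrder.ultralimit l mo) p) := by
    refine (Filter.eventually_all_finset _).2 fun e he => ?_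
    by_cases hne : e = leadExp (MonoOrder.ultralimit l mo) p
    · exact Filter.Eventually.of_forall fun i h => absurd hne h
    · exact (hlead e he hne).mono fun i hi _ => hi
  exact h.mono fun i hi => leadExp_eq_of_forall_lt hmem hi

lemma eventually_leadExps_eq {ι : Type*} (l : Ultrafilter ι) (mo : ι → MonoOrder N)
    (I : Ideal (MvPolynomial (Fin N) K)) :
    ∀ᶠ i in (l : Filter ι), leadExps (mo i) I = leadExps (MonoOrder.ultralimit l mo) I := by
  set E := leadExps (MonoOrder.ultralimit l mo) I
  have hfin : {a | Minimal (· ∈ E) a}.Finite :=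
    WellQuasiOrderedLE.finite_of_isAntichain (setOfPred_minimal_antichain _)
  have h : ∀ᶠ i in (l : Filter ι), ∀ a ∈ {a | Minimal (· ∈ E) a}, a ∈ leadExps (mo i) I := by
    refine (Filter.eventually_all_finite hfin).2 fun a ha => ?_
    obtain ⟨f, hf, hf0, rfl⟩ := ha.prop
    exact (eventually_leadExp_eq l mo hf0).mono fun i hi => ⟨f, hf, hf0, hi⟩
  refine h.mono fun i hi => (leadExps_eq_of_subset fun b hb => ?_).symm
  obtain ⟨a, hab, ha⟩ := exists_minimal_le_of_wellFoundedLT (· ∈ E) b hb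
  exact isUpperSet_leadExps (mo i) I hab (hi a ha)

lemma finite_setOf_ltIdealO (I : Ideal (MvPolynomial (Fin N) K)) :
    {J | ∃ mo : MonoOrder N, J = ltIdealO mo I}.Finite := by
  by_contra hinf
  set S := {J | ∃ mo : MonoOrder N, J = ltIdealO mo I}
  have : Infinite S := Set.infinite_coe_iff.2 hinf
  choose mo hmo using fun J : S => J.2
  let l := Filter.hyperfilter S
  let J₀ := ltIdealO (MonoOrder.ultralimit l mo) I
  have heq : ∀ᶠ J in (l : Filter S), J = ⟨J₀, _, rfl⟩ :=
    (eventually_leadExps_eq l mo I).mono fun J hJ => Subtype.ext <| by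
      rw [hmo J, ltIdealO_eq_span_leadExps, hJ, ← ltIdealO_eq_span_leadExps]
  exact Filter.notMem_hyperfilter_of_finite (Set.finite_singleton _) heq

end LeadingExponents

/-- For every ideal `I ⊆ K[X][U]` there are only finitely many distinct
Gröbner cones, equivalently only finitely many distinct initial ideals `⟨lt_≺(I)⟩`. -/
theorem finitely_many_groebner_cones (n m : ℕ) {K : Type*} [Field K]
    (I : Ideal (MvPolynomial (Fin (n + m)) K)) :
    {J : Ideal (MvPolynomial (Fin (n + m)) K) |
        ∃ mo : MonoOrder (n + m), J = ltIdealO mo I}.Finite ∧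
    {C : Set (Fin (n + m) → ℝ) | ∃ mo : MonoOrder (n + m), C = gCone mo I}.Finite := by
  refine ⟨finite_setOf_ltIdealO I, ((finite_setOf_ltIdealO I).image fun J =>
    closure {ω : Fin (n + m) → ℝ | (∀ i, 0 ≤ ω i) ∧ ltIdealW ω I = J}).subset ?_⟩
  rintro _ ⟨mo, rfl⟩
  exact ⟨ltIdealO mo I, ⟨mo, rfl⟩, rfl⟩
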